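/- For every n ≥ 1 and every parking function x = (a, x_2, …, x_n) of length n, there exist unique integers p, q ≥ 0 with p + q = n − 1, a unique a ∈ {1, …, p+1} (namely the first entry of x), a unique (p,q)-shuffle θ, and unique parking functions f ∈ PF_p and g ∈ PF_q, such that x = (a, θ_*(f_1, …, f_p, p+1+g_1, …, p+1+g_q)). -/

import Mathlib

/-- A parking function of length `n` is a sequence of positive integers
`(i_1, …, i_n)` such that its nondecreasing rearrangement `j_1 ≤ … ≤ j_n`
satisfies `1 ≤ j_k ≤ k` for every `k`. -/
def IsParkingFunction {n : ℕ} (f : Fin n → ℕ) : Prop :=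
  ∃ σ : Equiv.Perm (Fin n),
    Monotone (f ∘ σ) ∧ ∀ k : Fin n, 1 ≤ f (σ k) ∧ f (σ k) ≤ (k : ℕ) + 1

/-- A `(p,q)`-shuffle: a permutation of `{0, …, p+q-1}` that is increasing on
the first `p` indices and on the last `q` indices. -/
def IsShuffle (p q : ℕ) (θ : Equiv.Perm (Fin (p + q))) : Prop :=
  (∀ i j : Fin (p + q), (i : ℕ) < p → (j : ℕ) < p → i < j → θ i < θ j) ∧
  (∀ i j : Fin (p + q), p ≤ (i : ℕ) → p ≤ (j : ℕ) → i < j → θ i < θ j)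

/-- The concatenation `(f_1, …, f_p, p+1+g_1, …, p+1+g_q)`. -/
def concatShift (p q : ℕ) (f : Fin p → ℕ) (g : Fin q → ℕ) : Fin (p + q) → ℕ :=
  fun i => if h : (i : ℕ) < p then f ⟨i, h⟩
    else p + 1 + g ⟨(i : ℕ) - p, by have := i.isLt; omega⟩

/-- The sequence `(a, θ_*(f_1, …, f_p, p+1+g_1, …, p+1+g_q))`, where `θ_*(x)`
is the sequence whose `θ(i)`-th entry is `x_i`. -/
def buildSeq (p q : ℕ) (a : ℕ) (θ : Equiv.Perm (Fin (p + q)))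
    (f : Fin p → ℕ) (g : Fin q → ℕ) : Fin (p + q + 1) → ℕ :=
  Fin.cons a (concatShift p q f g ∘ θ.symm)

/-- The set of `(p,q)`-shuffles. -/
def Sh (p q : ℕ) := {θ : Equiv.Perm (Fin (p + q)) // IsShuffle p q θ}

/-- The set of parking functions of length `n`. -/
def PF (n : ℕ) := {f : Fin n → ℕ // IsParkingFunction f}

/-- The disjoint union, over `p, q ≥ 0` with `p + q = n - 1`, of the sets
`{1, …, p+1} × Sh(p,q) × PF_p × PF_q`. -/
def PFDomain (n : ℕ) :=
  Σ pq : {pq : ℕ × ℕ // pq.1 + pq.2 + 1 = n},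
    {a : ℕ // 1 ≤ a ∧ a ≤ pq.1.1 + 1} × Sh pq.1.1 pq.1.2 × PF pq.1.1 × PF pq.1.2

/-- The map `π(a, θ, f, g) = (a, θ_*(f_1, …, f_p, p+1+g_1, …, p+1+g_q))`. -/
def piMap (n : ℕ) (t : PFDomain n) : Fin n → ℕ := fun i =>
  buildSeq t.1.1.1 t.1.1.2 t.2.1.1 t.2.2.1.1 t.2.2.2.1.1 t.2.2.2.2.1
    (Fin.cast t.1.2.symm i)

/-- number of indices with value at most `k` -/
def cnt {n : ℕ} (f : Fin n → ℕ) (k : ℕ) : ℕ := (Finset.univ.filter (fun i => f i ≤ k)).card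

theorem cnt_eq_sum {n : ℕ} (f : Fin n → ℕ) (k : ℕ) :
    cnt f k = ∑ i, if f i ≤ k then 1 else 0 := by
  rw [cnt, Finset.card_filter]

theorem cnt_mono {n : ℕ} (f : Fin n → ℕ) {k l : ℕ} (h : k ≤ l) : cnt f k ≤ cnt f l := by
  unfold cnt
  apply Finset.card_le_card
  intro i
  simp only [Finset.mem_filter, Finset.mem_univ, true_and]
  omega

theorem cnt_le {n : ℕ} (f : Fin n → ℕ) (k : ℕ) : cnt f k ≤ n := by
  unfold cnt
  exact (Finset.card_le_univ _).trans (by simp)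

theorem cnt_cons {n : ℕ} (a : ℕ) (y : Fin n → ℕ) (k : ℕ) :
    cnt (Fin.cons a y : Fin (n+1) → ℕ) k = (if a ≤ k then 1 else 0) + cnt y k := by
  simp only [cnt_eq_sum, Fin.sum_univ_succ, Fin.cons_zero, Fin.cons_succ]

theorem cnt_perm {n : ℕ} (y : Fin n → ℕ) (θ : Equiv.Perm (Fin n)) (k : ℕ) :
    cnt (y ∘ θ) k = cnt y k := by
  simp only [cnt_eq_sum, Function.comp]
  exact Equiv.sum_comp θ (fun i => if y i ≤ k then 1 else 0)

theorem concatShift_left (p q : ℕ) (f : Fin p → ℕ) (g : Fin q → ℕ) (i : Fin p) :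
    concatShift p q f g (Fin.castAdd q i) = f i := by
  simp [concatShift]

theorem concatShift_right (p q : ℕ) (f : Fin p → ℕ) (g : Fin q → ℕ) (i : Fin q) :
    concatShift p q f g (Fin.natAdd p i) = p + 1 + g i := by
  simp [concatShift]

theorem cnt_concat (p q : ℕ) (f : Fin p → ℕ) (g : Fin q → ℕ) (k : ℕ) :
    cnt (concatShift p q f g) k = cnt f k + cnt (fun i => p + 1 + g i) k := by
  simp only [cnt_eq_sum, Fin.sum_univ_add, concatShift_left, concatShift_right]

theorem pf_iff {n : ℕ} (f : Fin n → ℕ) :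
    IsParkingFunction f ↔ (∀ i, 1 ≤ f i) ∧ ∀ k ≤ n, k ≤ cnt f k := by
  constructor
  · rintro ⟨σ, -, h⟩
    refine ⟨fun i => by simpa using (h (σ.symm i)).1, fun k hk => ?_⟩
    rw [← cnt_perm f σ]
    unfold cnt
    calc k = (Finset.univ.map (Fin.castLEEmb hk)).card := by simp
      _ ≤ _ := by
        apply Finset.card_le_card
        intro i hi
        simp only [Finset.mem_map, Finset.mem_univ, true_and] at hi
        obtain ⟨j, rfl⟩ := hi
        simp only [Finset.mem_filter, Finset.mem_univ, true_and, Function.comp]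
        have := (h (Fin.castLEEmb hk j)).2
        have h2 := j.isLt
        simp at this ⊢
        omega
  · rintro ⟨h1, h2⟩
    refine ⟨Tuple.sort f, Tuple.monotone_sort f, fun k => ⟨h1 _, ?_⟩⟩
    by_contra hc
    have h3 := h2 (k+1) k.isLt
    rw [← cnt_perm f (Tuple.sort f)] at h3
    unfold cnt at h3
    have : (Finset.univ.filter (fun i => (f ∘ Tuple.sort f) i ≤ k + 1)).card ≤ (Finset.Iio k).card := by
      apply Finset.card_le_card
      intro i hi
      simp only [Finset.mem_filter, Finset.mem_univ, true_and] at hi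
      simp only [Finset.mem_Iio]
      by_contra hik
      have := Tuple.monotone_sort f (not_lt.mp hik)
      simp only [Function.comp] at this hi
      omega
    simp at this h3
    omega

theorem pf_le {n : ℕ} {f : Fin n → ℕ} (h : IsParkingFunction f) (i : Fin n) : f i ≤ n := by
  obtain ⟨σ, -, h⟩ := h
  have := (h (σ.symm i)).2
  simp at this
  have h2 := (σ.symm i).isLt
  omega

theorem pf_pos {n : ℕ} {f : Fin n → ℕ} (h : IsParkingFunction f) (i : Fin n) : 1 ≤ f i :=
  ((pf_iff f).1 h).1 i

theorem cnt_zero_of {n : ℕ} (f : Fin n → ℕ) (k : ℕ) (h : ∀ i, k < f i) : cnt f k = 0 := by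
  unfold cnt
  rw [Finset.card_eq_zero, Finset.filter_eq_empty_iff]
  intro i _
  have := h i
  omega

/-- `p` is determined by the tail. -/
theorem tail_char {p q : ℕ} {f : Fin p → ℕ} {g : Fin q → ℕ} (θ : Equiv.Perm (Fin (p + q)))
    (hf : IsParkingFunction f) (hg : IsParkingFunction g) :
    cnt (concatShift p q f g ∘ θ.symm) (p+1) ≤ p ∧
    ∀ k ≤ p, k ≤ cnt (concatShift p q f g ∘ θ.symm) k := by
  rw [cnt_perm, cnt_concat]
  constructor
  · rw [cnt_zero_of (fun i => p + 1 + g i)]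
    · exact cnt_le f _
    · intro i
      have := pf_pos hg i
      omega
  · intro k hk
    rw [cnt_perm, cnt_concat]
    have := ((pf_iff f).1 hf).2 k hk
    omega

theorem concat_le_iff {p q : ℕ} {f : Fin p → ℕ} {g : Fin q → ℕ}
    (hf : IsParkingFunction f) (i : Fin (p+q)) :
    concatShift p q f g i ≤ p ↔ (i : ℕ) < p := by
  unfold concatShift
  split_ifs with h
  · simp [h, pf_le hf]
  · simp [h]; omega

theorem card_univ_filter_lt (p q : ℕ) :
    (Finset.univ.filter (fun i : Fin (p+q) => (i : ℕ) < p)).card = p := by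
  rw [Finset.card_filter, Fin.sum_univ_add]
  simp

theorem theta_unique {p q : ℕ} (y : Fin (p+q) → ℕ) (θ θ' : Equiv.Perm (Fin (p + q)))
    (hθ : IsShuffle p q θ) (hθ' : IsShuffle p q θ')
    (h : ∀ i, y (θ i) ≤ p ↔ (i : ℕ) < p) (h' : ∀ i, y (θ' i) ≤ p ↔ (i : ℕ) < p) : θ = θ' := by
  have hc : (Finset.univ.filter (fun i => y i ≤ p)).card = p := by
    change cnt y p = p
    rw [← cnt_perm y θ]
    unfold cnt
    simp only [Function.comp, h]
    exact card_univ_filter_lt p q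
  have hc' : (Finset.univ.filter (fun i => ¬ y i ≤ p)).card = q := by
    have := Finset.card_filter_add_card_filter_not (s := (Finset.univ : Finset (Fin (p+q))))
      (fun i => y i ≤ p)
    rw [hc] at this
    simpa using this
  have L : ∀ θ : Equiv.Perm (Fin (p + q)), IsShuffle p q θ → (∀ i, y (θ i) ≤ p ↔ (i : ℕ) < p) →
      (fun i => θ (Fin.castAdd q i)) = Finset.orderEmbOfFin _ hc := by
    intro θ hθ h
    apply Finset.orderEmbOfFin_unique
    · intro i
      simp [h]
    · intro i j hij
      exact hθ.1 _ _ (by simp) (by simp) (by exact hij)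
  have R : ∀ θ : Equiv.Perm (Fin (p + q)), IsShuffle p q θ → (∀ i, y (θ i) ≤ p ↔ (i : ℕ) < p) →
      (fun i => θ (Fin.natAdd p i)) = Finset.orderEmbOfFin _ hc' := by
    intro θ hθ h
    apply Finset.orderEmbOfFin_unique
    · intro i
      simp only [Finset.mem_filter, Finset.mem_univ, true_and, h]
      simp
    · intro i j hij
      exact hθ.2 _ _ (by simp) (by simp) (by simpa using hij)
  ext1 i
  induction i using Fin.addCases with
  | left i => exact congrFun ((L θ hθ h).trans (L θ' hθ' h').symm) i
  | right i => exact congrFun ((R θ hθ h).trans (R θ' hθ' h').symm) i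

theorem unique_aux {n : ℕ} (t t' : PFDomain n) (h : piMap n t = piMap n t') : t = t' := by
  obtain ⟨⟨⟨p, q⟩, hpq⟩, ⟨a, ha⟩, ⟨θ, hθ⟩, ⟨f, hf⟩, ⟨g, hg⟩⟩ := t
  obtain ⟨⟨⟨p', q'⟩, hpq'⟩, ⟨a', ha'⟩, ⟨θ', hθ'⟩, ⟨f', hf'⟩, ⟨g', hg'⟩⟩ := t'
  simp only at hpq hpq' ha ha' θ hθ θ' hθ' f hf g hg f' hf' g' hg'
  have key : ∃ m, n = m + 1 := ⟨n - 1, by omega⟩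
  obtain ⟨m, rfl⟩ := key
  have e1 : p + q = m := by omega
  have e2 : p' + q' = m := by omega
  -- the tail counts
  have C : ∀ (p q : ℕ) (e : p + q = m) (hpq : p + q + 1 = m + 1) (a : ℕ) 
      (θ : Equiv.Perm (Fin (p + q))) (f : Fin p → ℕ) (g : Fin q → ℕ) (k : ℕ),
      cnt (fun i : Fin m => buildSeq p q a θ f g (Fin.cast hpq.symm i.succ)) k =
        cnt (concatShift p q f g ∘ θ.symm) k := by
    intro p q e hpq a θ f g k
    subst e
    rfl
  have hC : ∀ k, cnt (concatShift p q f g ∘ θ.symm) k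
      = cnt (concatShift p' q' f' g' ∘ θ'.symm) k := by
    intro k
    rw [← C p q e1 hpq a θ f g k, ← C p' q' e2 hpq' a' θ' f' g' k]
    congr 1
    funext i
    exact congrFun h i.succ
  have T := tail_char θ hf hg
  have T' := tail_char θ' hf' hg'
  have hp : p = p' := by
    rcases lt_trichotomy p p' with hlt | heq | hlt
    · have := T'.2 (p+1) hlt
      rw [← hC] at this
      have := T.1
      omega
    · exact heq
    · have := T.2 (p'+1) hlt
      rw [hC] at this
      have := T'.1
      omega
  subst hp
  have hq : q = q' := by omega
  subst hq
  subst e1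
  have h0 : a = a' := congrFun h 0
  subst h0
  have hy : concatShift p q f g ∘ θ.symm = concatShift p q f' g' ∘ θ'.symm := by
    funext i
    exact congrFun h i.succ
  have hth : θ = θ' := by
    apply theta_unique (concatShift p q f g ∘ θ.symm) θ θ' hθ hθ'
    · intro i
      simp [concat_le_iff hf]
    · intro i
      rw [hy]
      simp [concat_le_iff hf']
  subst hth
  have hz : concatShift p q f g = concatShift p q f' g' := by
    funext i
    simpa using congrFun hy (θ i)
  have hff : f = f' := by
    funext i
    rw [← concatShift_left p q f g, hz, concatShift_left]
  have hgg : g = g' := by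
    funext i
    have := congrFun hz (Fin.natAdd p i)
    rw [concatShift_right, concatShift_right] at this
    omega
  subst hff hgg
  rfl

theorem exists_aux (p q : ℕ) (a : ℕ) (y : Fin (p+q) → ℕ)
    (hx : IsParkingFunction (Fin.cons a y : Fin (p+q+1) → ℕ))
    (h1 : cnt y (p+1) ≤ p) (h2 : ∀ k ≤ p, k ≤ cnt y k) :
    ∃ t : PFDomain (p+q+1), piMap _ t = Fin.cons a y := by
  rw [pf_iff] at hx
  obtain ⟨hpos, hcnt⟩ := hx
  have ha1 : 1 ≤ a := hpos 0
  have hy1 : ∀ i, 1 ≤ y i := fun i => hpos i.succ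
  have hap : a ≤ p + 1 := by
    by_contra hc
    have := hcnt (p+1) (by omega)
    rw [cnt_cons, if_neg hc] at this
    omega
  have hcp : cnt y p = p := le_antisymm ((cnt_mono y (by omega)).trans h1) (h2 p le_rfl)
  have hcp1 : cnt y (p+1) = p := le_antisymm h1 (hcp.symm.le.trans (cnt_mono y (by omega)))
  have hne : ∀ i, y i ≤ p + 1 → y i ≤ p := by
    have hs : (Finset.univ.filter (fun i => y i ≤ p)) = (Finset.univ.filter (fun i => y i ≤ p+1)) := by
      apply Finset.eq_of_subset_of_card_le
      · intro i
        simp only [Finset.mem_filter, Finset.mem_univ, true_and]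
        omega
      · change cnt y (p+1) ≤ cnt y p
        omega
    intro i hi
    have : i ∈ (Finset.univ.filter (fun i => y i ≤ p)) := by
      rw [hs]; simpa using hi
    simpa using this
  have hS : (Finset.univ.filter (fun i => y i ≤ p)).card = p := hcp
  have hSc : (Finset.univ.filter (fun i => y i ≤ p))ᶜ.card = q := by
    rw [Finset.card_compl, hS]; simp
  let θ : Equiv.Perm (Fin (p+q)) := finSumFinEquiv.symm.trans (finSumEquivOfFinset hS hSc)
  have hθl : ∀ i, θ (Fin.castAdd q i) = Finset.orderEmbOfFin _ hS i := by
    intro i; simp [θ]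
  have hθr : ∀ i, θ (Fin.natAdd p i) = Finset.orderEmbOfFin _ hSc i := by
    intro i; simp [θ]
  have hl : ∀ i, y (θ (Fin.castAdd q i)) ≤ p := by
    intro i
    have := Finset.orderEmbOfFin_mem _ hS i
    rw [← hθl] at this
    simpa using this
  have hr : ∀ i, p + 1 < y (θ (Fin.natAdd p i)) := by
    intro i
    have := Finset.orderEmbOfFin_mem _ hSc i
    rw [← hθr] at this
    simp at this
    by_contra hc
    have := hne _ (not_lt.mp hc)
    omega
  have hsh : IsShuffle p q θ := by
    constructor
    · intro i j hi hj hij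
      have := (Finset.orderEmbOfFin _ hS).strictMono (a := ⟨i, hi⟩) (b := ⟨j, hj⟩) hij
      rw [← hθl, ← hθl] at this
      exact this
    · intro i j hi hj hij
      induction i using Fin.addCases with
      | left i => simp at hi; omega
      | right i =>
        induction j using Fin.addCases with
        | left j => simp at hj; omega
        | right j =>
          rw [hθr, hθr]
          apply (Finset.orderEmbOfFin _ hSc).strictMono
          simpa using hij
  let f : Fin p → ℕ := fun i => y (θ (Fin.castAdd q i))
  let g : Fin q → ℕ := fun i => y (θ (Fin.natAdd p i)) - (p+1)
  have hcs : concatShift p q f g = y ∘ θ := by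
    funext i
    induction i using Fin.addCases with
    | left i => rw [concatShift_left]; rfl
    | right i =>
      rw [concatShift_right]
      have := hr i
      simp only [g, Function.comp]
      omega
  have hsplit : ∀ k, cnt y k = cnt f k + cnt (fun i => p + 1 + g i) k := by
    intro k
    rw [← cnt_concat, hcs, cnt_perm]
  have hgpos : ∀ i, 1 ≤ g i := by
    intro i
    have := hr i
    simp only [g]
    omega
  have hf : IsParkingFunction f := by
    rw [pf_iff]
    refine ⟨fun i => hy1 _, fun k hk => ?_⟩
    have h3 := h2 k hk
    rw [hsplit, cnt_zero_of (fun i => p + 1 + g i)] at h3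
    · simpa using h3
    · intro i; omega
  have hg : IsParkingFunction g := by
    rw [pf_iff]
    refine ⟨hgpos, fun k hk => ?_⟩
    have h3 := hcnt (p + 1 + k) (by omega)
    rw [cnt_cons, if_pos (by omega), hsplit] at h3
    have h4 := cnt_le f (p+1+k)
    have h5 : cnt (fun i => p + 1 + g i) (p+1+k) = cnt g k := by
      unfold cnt
      congr 1
      ext i
      simp
    omega
  refine ⟨⟨⟨(p, q), rfl⟩, ⟨a, ha1, hap⟩, ⟨θ, hsh⟩, ⟨f, hf⟩, ⟨g, hg⟩⟩, ?_⟩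
  funext i
  simp only [piMap, buildSeq, hcs]
  refine Fin.cases ?_ (fun i => ?_) i
  · rfl
  · simp

/-- every parking function `x` of length `n ≥ 1` can be written
uniquely as `x = (a, θ_*(f_1, …, f_p, p+1+g_1, …, p+1+g_q))` for integers
`p, q ≥ 0` with `p + q = n - 1`, an `a ∈ {1, …, p+1}`, a `(p,q)`-shuffle `θ`,
and parking functions `f ∈ PF_p`, `g ∈ PF_q`. -/
theorem parkingFunction_unique_decomposition (n : ℕ) (hn : 1 ≤ n)
    (x : Fin n → ℕ) (hx : IsParkingFunction x) :
    ∃! t : PFDomain n, piMap n t = x := by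
  refine existsUnique_of_exists_of_unique ?_ (fun t t' h h' => unique_aux t t' (h.trans h'.symm))
  obtain ⟨m, rfl⟩ : ∃ m, n = m + 1 := ⟨n - 1, by omega⟩
  have hxx : x = Fin.cons (x 0) (Fin.tail x) := (Fin.cons_self_tail x).symm
  generalize x 0 = a at hxx
  generalize Fin.tail x = y at hxx
  subst hxx
  have hex : ∃ p, cnt y (p+1) ≤ p := ⟨m, cnt_le y _⟩
  classical
  have hle : Nat.find hex ≤ m := Nat.find_min' hex (cnt_le y _)
  have hs := Nat.find_spec hex
  have hm : ∀ k ≤ Nat.find hex, k ≤ cnt y k := by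
    intro k hk
    rcases k with _ | k
    · omega
    · have := Nat.find_min hex (m := k) (by omega)
      omega
  generalize Nat.find hex = p at hle hs hm
  clear hex
  obtain ⟨q, rfl⟩ := Nat.exists_eq_add_of_le hle
  exact exists_aux p q a y hx hs hm
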